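/- Let a, b be positive real numbers with a ≠ b, let k ≥ 0 be an integer, and set θ = 2π/3. Then ∫₀^∞ t (log t)^k / ((t² + a t + a²)(t² + b t + b²)) dt = (θ^{k+1}(a+b)/(a³−b³)) · [R_k(log a / θ) − R_k(log b / θ)] + (θ^{k+1}/(√3 (a² + a b + b²))) · [S_k(log a / θ) + S_k(log b / θ)]. -/

import Mathlib

open Finset

/-- Non-recursive part of `Rpoly`. -/
noncomputable def GR (k : ℕ) : Polynomial ℝ :=
  Polynomial.C ((1 : ℝ) / (2 * (k + 1))) *
    ∑ j ∈ (Finset.range (k + 2)).filter (fun j => Even j),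
      Polynomial.C ((-1 : ℝ) ^ (j / 2) * ((k + 1).choose j : ℝ) * ((2 : ℝ) ^ j + 1)) *
        Polynomial.X ^ (k + 1 - j)

noncomputable def GS (k : ℕ) : Polynomial ℝ :=
  Polynomial.C ((1 : ℝ) / (2 * (k + 1))) *
    ∑ j ∈ (Finset.range (k + 2)).filter (fun j => Odd j),
      Polynomial.C ((-1 : ℝ) ^ ((j + 1) / 2) * ((k + 1).choose j : ℝ) * ((2 : ℝ) ^ j - 1)) *
        Polynomial.X ^ (k + 1 - j)

noncomputable def GP (k : ℕ) : Polynomial ℝ :=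
  Polynomial.C ((1 : ℝ) / (2 * (k + 1))) *
    ∑ j ∈ (Finset.range (k + 2)).filter (fun j => Even j),
      Polynomial.C ((-1 : ℝ) ^ (j / 2) * ((k + 1).choose j : ℝ) * ((5 : ℝ) ^ j + 1)) *
        Polynomial.X ^ (k + 1 - j)

noncomputable def GQ (k : ℕ) : Polynomial ℝ :=
  Polynomial.C ((1 : ℝ) / (2 * (k + 1))) *
    ∑ j ∈ (Finset.range (k + 2)).filter (fun j => Odd j),
      Polynomial.C ((-1 : ℝ) ^ ((j - 1) / 2) * ((k + 1).choose j : ℝ) * ((5 : ℝ) ^ j - 1)) *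
        Polynomial.X ^ (k + 1 - j)

noncomputable def GY (k : ℕ) : Polynomial ℝ :=
  Polynomial.C (-((1 : ℝ) / (k + 1))) *
    (Polynomial.X ^ (k + 1) +
      ∑ j ∈ (Finset.range (k + 2)).filter (fun j => Even j),
        Polynomial.C ((-1 : ℝ) ^ (j / 2) * ((k + 1).choose j : ℝ) * ((3 : ℝ) ^ j)) *
          Polynomial.X ^ (k + 1 - j))

noncomputable def GZ (k : ℕ) : Polynomial ℝ :=
  Polynomial.C (-((2 : ℝ) / (k + 1))) *
    ∑ j ∈ (Finset.range (k + 2)).filter (fun j => Even j),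
      Polynomial.C ((-1 : ℝ) ^ (j / 2) * ((k + 1).choose j : ℝ) * ((3 : ℝ) ^ j)) *
        Polynomial.X ^ (k + 1 - j)

/-- The common recursion: `F k = (1/(k+1)) ∑_{3 ≤ j ≤ k+1, j odd}
(−1)^{(j+1)/2} C(k+1,j) m^{j−1} F_{k+1−j} + G k`. -/
noncomputable def recFam (m : ℝ) (G : ℕ → Polynomial ℝ) : ℕ → Polynomial ℝ := fun k =>
  Nat.strongRecOn k fun k ih =>
    Polynomial.C ((1 : ℝ) / (k + 1)) *
      (∑ j ∈ ((Finset.range (k + 2)).filter (fun j => Odd j ∧ 3 ≤ j)).attach,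
        Polynomial.C ((-1 : ℝ) ^ ((j.1 + 1) / 2) * ((k + 1).choose j.1 : ℝ) * m ^ (j.1 - 1)) *
          ih (k + 1 - j.1) (by
            have hj := j.2
            simp only [Finset.mem_filter, Finset.mem_range] at hj
            omega))
    + G k

noncomputable def Rpoly : ℕ → Polynomial ℝ := recFam 3 GR
noncomputable def Spoly : ℕ → Polynomial ℝ := recFam 3 GS
noncomputable def Ppoly : ℕ → Polynomial ℝ := recFam 6 GP
noncomputable def Qpoly : ℕ → Polynomial ℝ := recFam 6 GQ
noncomputable def Ypoly : ℕ → Polynomial ℝ := recFam 3 GY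
noncomputable def Zpoly : ℕ → Polynomial ℝ := recFam 6 GZ

open MeasureTheory


lemma integrableOn_rpow_div_quadratic {p : ℝ} (hp0 : 0 < p) (hp2 : p < 2) :
    IntegrableOn (fun t : ℝ => t ^ (p - 1) / (t ^ 2 + t + 1)) (Set.Ioi 0) := by
  have hcont : ContinuousOn (fun t : ℝ => t ^ (p - 1) / (t ^ 2 + t + 1)) (Set.Ioi 0) := by
    refine ContinuousOn.div (fun t ht => ?_) (by fun_prop) (fun t ht => ?_)
    · exact (Real.continuousAt_rpow_const t _ (Or.inl (ne_of_gt ht))).continuousWithinAt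
    · have : 0 < t := ht
      positivity
  have h1 : IntegrableOn (fun t : ℝ => t ^ (p - 1) / (t ^ 2 + t + 1)) (Set.Ioc 0 1) := by
    have hg : IntegrableOn (fun t : ℝ => t ^ (p - 1)) (Set.Ioc 0 1) := by
      rw [integrableOn_Ioc_iff_integrableOn_Ioo,
        intervalIntegral.integrableOn_Ioo_rpow_iff one_pos]
      linarith
    refine Integrable.mono' hg
      ((hcont.mono Set.Ioc_subset_Ioi_self).aestronglyMeasurable measurableSet_Ioc) ?_
    filter_upwards [ae_restrict_mem measurableSet_Ioc] with t ht
    have ht0 : 0 < t := ht.1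
    rw [Real.norm_of_nonneg (by positivity)]
    exact div_le_self (by positivity) (by nlinarith)
  have h2 : IntegrableOn (fun t : ℝ => t ^ (p - 1) / (t ^ 2 + t + 1)) (Set.Ioi 1) := by
    refine Integrable.mono' (integrableOn_Ioi_rpow_of_lt (a := p - 3) (by linarith) one_pos)
      ((hcont.mono (Set.Ioi_subset_Ioi zero_le_one)).aestronglyMeasurable measurableSet_Ioi) ?_
    filter_upwards [ae_restrict_mem measurableSet_Ioi] with t ht
    have ht0 : 0 < t := lt_trans one_pos ht
    rw [Real.norm_of_nonneg (by positivity), show p - 3 = (p - 1) - (2 : ℕ) by push_cast; ring,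
      Real.rpow_sub_natCast ht0.ne']
    gcongr
    nlinarith
  rw [← Set.Ioc_union_Ioi_eq_Ioi zero_le_one]
  exact h1.union h2

lemma summable_one_div_sub_one_div {q : ℝ} (hq : 0 < q) :
    Summable fun n : ℕ => 1 / (3 * n + q) - 1 / (3 * n + q + 1) := by
  have h := ((summable_nat_add_iff 1).mpr (Real.summable_one_div_nat_pow.mpr one_lt_two)).mul_left
    (1 + 1 / q)
  refine Summable.of_nonneg_of_le (fun n => ?_) (fun n => ?_) h
  · rw [sub_nonneg]
    exact one_div_le_one_div_of_le (by positivity) (by linarith)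
  · have hn : (0 : ℝ) ≤ n := n.cast_nonneg
    rw [div_sub_div _ _ (by positivity) (by positivity), show (1 + 1 / q) = (q + 1) / q by
      field_simp, div_mul_div_comm, div_le_div_iff₀ (by positivity) (by positivity)]
    push_cast
    nlinarith [mul_nonneg hn hn, mul_nonneg hn hq.le, mul_nonneg (mul_nonneg hn hn) hq.le,
      mul_nonneg hq.le hq.le, mul_nonneg hn (mul_nonneg hq.le hq.le)]

lemma hasSum_setIntegral_Ioc {p : ℝ} (hp0 : 0 < p) :
    HasSum (fun n : ℕ => 1 / (3 * n + p) - 1 / (3 * n + p + 1))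
      (∫ t in Set.Ioc (0 : ℝ) 1, t ^ (p - 1) / (t ^ 2 + t + 1)) := by
  have hint (q : ℝ) (hq : 0 < q) : IntegrableOn (fun t : ℝ => t ^ (q - 1)) (Set.Ioc 0 1) := by
    rw [integrableOn_Ioc_iff_integrableOn_Ioo,
      intervalIntegral.integrableOn_Ioo_rpow_iff one_pos]
    linarith
  have hval (q : ℝ) (hq : 0 < q) : ∫ t in Set.Ioc (0 : ℝ) 1, t ^ (q - 1) = 1 / q := by
    rw [← intervalIntegral.integral_of_le zero_le_one, integral_rpow (Or.inl (by linarith))]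
    simp [hq.ne']
  have hF (n : ℕ) : ∫ t in Set.Ioc (0 : ℝ) 1,
      (t ^ ((3 * n + p) - 1) - t ^ ((3 * n + p + 1) - 1)) =
        1 / (3 * n + p) - 1 / (3 * n + p + 1) := by
    rw [integral_sub (hint _ (by positivity)) (hint _ (by positivity)),
      hval _ (by positivity), hval _ (by positivity)]
  have key := hasSum_integral_of_summable_integral_norm (μ := volume.restrict (Set.Ioc (0 : ℝ) 1))
    (F := fun (n : ℕ) (t : ℝ) => t ^ ((3 * n + p) - 1) - t ^ ((3 * n + p + 1) - 1))
    (fun n => (hint _ (by positivity)).sub (hint _ (by positivity))) ?_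
  · simp only [hF] at key
    convert! key using 1
    rw [integral_Ioc_eq_integral_Ioo, integral_Ioc_eq_integral_Ioo]
    refine setIntegral_congr_fun measurableSet_Ioo fun t ht => ?_
    have ht0 : 0 < t := ht.1
    have ht3 : t ^ 3 < 1 := pow_lt_one₀ ht0.le ht.2 (by norm_num)
    have hg := (hasSum_geometric_of_lt_one (by positivity) ht3).mul_left (t ^ (p - 1) * (1 - t))
    refine Eq.trans ?_ (hg.tsum_eq.symm.trans (tsum_congr fun n => ?_))
    · have : 1 - t ^ 3 ≠ 0 := by linarith
      field_simp
      ring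
    · rw [show 3 * (n : ℝ) + p - 1 = (p - 1) + (3 * n : ℕ) by push_cast; ring,
        show 3 * (n : ℝ) + p + 1 - 1 = (p - 1) + (3 * n + 1 : ℕ) by push_cast; ring,
        Real.rpow_add_natCast ht0.ne', Real.rpow_add_natCast ht0.ne', pow_succ, pow_mul]
      ring
  · refine (summable_one_div_sub_one_div hp0).congr fun n => ?_
    rw [← hF]
    refine setIntegral_congr_fun measurableSet_Ioc fun t ht => ?_
    refine (Real.norm_of_nonneg (sub_nonneg.mpr ?_)).symm
    exact Real.rpow_le_rpow_of_exponent_ge ht.1 ht.2 (by linarith)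

lemma hasSum_setIntegral_Ioi_one {p : ℝ} (hp2 : p < 2) :
    HasSum (fun n : ℕ => 1 / (3 * n + (2 - p)) - 1 / (3 * n + (2 - p) + 1))
      (∫ t in Set.Ioi (1 : ℝ), t ^ (p - 1) / (t ^ 2 + t + 1)) := by
  have hp : 0 < 2 - p := by linarith
  have hint (q : ℝ) (hq : 0 < q) : IntegrableOn (fun t : ℝ => t ^ (-q - 1)) (Set.Ioi 1) :=
    integrableOn_Ioi_rpow_of_lt (by linarith) one_pos
  have hval (q : ℝ) (hq : 0 < q) : ∫ t in Set.Ioi (1 : ℝ), t ^ (-q - 1) = 1 / q := by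
    rw [integral_Ioi_rpow_of_lt (by linarith) one_pos]
    simp
  have hF (n : ℕ) : ∫ t in Set.Ioi (1 : ℝ),
      (t ^ (-(3 * n + (2 - p)) - 1) - t ^ (-(3 * n + (2 - p) + 1) - 1)) =
        1 / (3 * n + (2 - p)) - 1 / (3 * n + (2 - p) + 1) := by
    rw [integral_sub (hint _ (by positivity)) (hint _ (by positivity)),
      hval _ (by positivity), hval _ (by positivity)]
  have key := hasSum_integral_of_summable_integral_norm (μ := volume.restrict (Set.Ioi (1 : ℝ)))
    (F := fun (n : ℕ) (t : ℝ) => t ^ (-(3 * n + (2 - p)) - 1) - t ^ (-(3 * n + (2 - p) + 1) - 1))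
    (fun n => (hint _ (by positivity)).sub (hint _ (by positivity))) ?_
  · simp only [hF] at key
    convert! key using 1
    refine setIntegral_congr_fun measurableSet_Ioi fun t ht => ?_
    have ht1 : 1 < t := ht
    have ht0 : 0 < t := lt_trans one_pos ht1
    have ht3 : 1 < t ^ 3 := one_lt_pow₀ ht1 (by norm_num)
    have hg := (hasSum_geometric_of_lt_one (r := (t ^ 3)⁻¹) (by positivity)
      (inv_lt_one_of_one_lt₀ ht3)).mul_left (t ^ (p - 1) * (t - 1) / t ^ 3)
    refine Eq.trans ?_ (hg.tsum_eq.symm.trans (tsum_congr fun n => ?_))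
    · have h1 : t ^ 3 - 1 ≠ 0 := by linarith
      have h2 : 1 - (t ^ 3)⁻¹ = (t ^ 3 - 1) / t ^ 3 := by field_simp
      rw [h2]
      field_simp
      ring
    · rw [show -(3 * (n : ℝ) + (2 - p)) - 1 = (p - 1) - (3 * n + 2 : ℕ) by push_cast; ring,
        show -(3 * (n : ℝ) + (2 - p) + 1) - 1 = (p - 1) - (3 * n + 3 : ℕ) by push_cast; ring,
        Real.rpow_sub_natCast ht0.ne', Real.rpow_sub_natCast ht0.ne', pow_add, pow_add, pow_mul,
        inv_pow]
      field_simp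
  · refine (summable_one_div_sub_one_div hp).congr fun n => ?_
    rw [← hF]
    refine setIntegral_congr_fun measurableSet_Ioi fun t ht => ?_
    refine (Real.norm_of_nonneg (sub_nonneg.mpr ?_)).symm
    exact Real.rpow_le_rpow_of_exponent_le (le_of_lt ht) (by linarith)

lemma hasSum_cot {x : ℝ} (hx0 : 0 < x) (hx1 : x < 1) :
    HasSum (fun n : ℕ => 1 / (x - (n + 1)) + 1 / (x + (n + 1)))
      (Real.pi * Real.cot (Real.pi * x) - 1 / x) := by
  have hx : (x : ℂ) ∈ Complex.integerComplement := by
    rintro ⟨m, hm⟩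
    have hm' : (m : ℝ) = x := by exact_mod_cast hm
    have h0 : 0 < m := by exact_mod_cast hm' ▸ hx0
    have h1 : m < 1 := by exact_mod_cast hm' ▸ hx1
    omega
  have h := (summable_cotTerm hx).hasSum
  have h' := cot_series_rep' hx
  rw [← Complex.hasSum_ofReal]
  push_cast
  rw [h']
  exact h

lemma integral_rpow_div_quadratic_cot {p : ℝ} (hp0 : 0 < p) (hp2 : p < 2) :
    ∫ t in Set.Ioi (0 : ℝ), t ^ (p - 1) / (t ^ 2 + t + 1) =
      Real.pi / 3 * (Real.cot (Real.pi * (p / 3)) - Real.cot (Real.pi * ((p + 1) / 3))) := by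
  have hi := integrableOn_rpow_div_quadratic hp0 hp2
  rw [← Set.Ioc_union_Ioi_eq_Ioi zero_le_one] at hi ⊢
  rw [setIntegral_union (Set.Ioc_disjoint_Ioi le_rfl) measurableSet_Ioi
    hi.left_of_union hi.right_of_union]
  have h1 := (hasSum_nat_add_iff' 1).mpr (hasSum_setIntegral_Ioc hp0)
  have h2 := hasSum_setIntegral_Ioi_one hp2
  have h3 := ((hasSum_cot (x := p / 3) (by linarith) (by linarith)).sub
    (hasSum_cot (x := (p + 1) / 3) (by linarith) (by linarith))).mul_left (1 / 3)
  have h4 := (h1.add h2).unique (h3.congr_fun fun n => ?_)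
  · simp only [Finset.sum_range_one, Nat.cast_zero] at h4
    have e1 : 1 / (p / 3) = 3 * (1 / p) := by field_simp
    have e2 : 1 / ((p + 1) / 3) = 3 * (1 / (p + 1)) := by field_simp
    rw [e1, e2] at h4
    simp only [mul_zero, zero_add] at h4
    linarith
  · have hn : (0 : ℝ) ≤ n := n.cast_nonneg
    have a1 : p / 3 - (n + 1) = -(3 * n + (2 - p) + 1) / 3 := by ring
    have a2 : p / 3 + (n + 1) = (3 * (n + 1) + p) / 3 := by ring
    have a3 : (p + 1) / 3 - (n + 1) = -(3 * n + (2 - p)) / 3 := by ring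
    have a4 : (p + 1) / 3 + (n + 1) = (3 * (n + 1) + p + 1) / 3 := by ring
    have b1 : (3 * n + (2 - p) + 1) ≠ 0 := by linarith
    have b3 : (3 * n + (2 - p)) ≠ 0 := by linarith
    rw [a1, a2, a3, a4]
    push_cast
    simp only [one_div_div, div_neg, neg_div]
    ring

lemma integral_rpow_div_quadratic {p : ℝ} (hp0 : 0 < p) (hp2 : p < 2) (hp1 : p ≠ 1) :
    ∫ t in Set.Ioi (0 : ℝ), t ^ (p - 1) / (t ^ 2 + t + 1) =
      2 * Real.pi / √3 * Real.sin (Real.pi * (1 - p) / 3) / Real.sin (Real.pi * p) := by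
  rw [integral_rpow_div_quadratic_cot hp0 hp2]
  have hpi := Real.pi_pos
  have hy0 : Real.sin (Real.pi * (p / 3)) ≠ 0 :=
    (Real.sin_pos_of_pos_of_lt_pi (by positivity) (by nlinarith)).ne'
  have hz0 : Real.sin (Real.pi * ((p + 1) / 3)) ≠ 0 :=
    (Real.sin_pos_of_pos_of_lt_pi (by positivity) (by nlinarith)).ne'
  have hy : Real.pi * ((p + 1) / 3) = Real.pi * (p / 3) + Real.pi / 3 := by ring
  have hw : Real.pi * (1 - p) / 3 = Real.pi / 3 - Real.pi * (p / 3) := by ring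
  have h3 : Real.pi * p = 3 * (Real.pi * (p / 3)) := by ring
  have hs0 : Real.sin (Real.pi * p) ≠ 0 := by
    intro h
    obtain ⟨m, hm⟩ := Real.sin_eq_zero_iff.mp h
    have : (m : ℝ) = p := by
      have := mul_comm (m : ℝ) Real.pi ▸ hm
      exact mul_left_cancel₀ hpi.ne' this
    have h0 : 0 < m := by exact_mod_cast this ▸ hp0
    have h2 : m < 2 := by exact_mod_cast this ▸ hp2
    obtain rfl : m = 1 := by omega
    exact hp1 (by simpa using this.symm)
  rw [Real.cot_eq_cos_div_sin, Real.cot_eq_cos_div_sin]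
  rw [h3] at hs0 ⊢
  rw [hw]
  rw [hy] at hz0 ⊢
  set y := Real.pi * (p / 3)
  have hsq : √3 ^ 2 = 3 := Real.sq_sqrt (by norm_num)
  have hsq0 : √3 ≠ 0 := by positivity
  have hcs := Real.sin_sq_add_cos_sq y
  rw [div_sub_div _ _ hy0 hz0]
  have hnum : Real.cos y * Real.sin (y + Real.pi / 3) - Real.sin y * Real.cos (y + Real.pi / 3)
      = √3 / 2 := by
    rw [Real.sin_add, Real.cos_add, Real.sin_pi_div_three, Real.cos_pi_div_three]
    linear_combination (√3 / 2) * hcs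
  have hden : Real.sin (3 * y) = 4 * (Real.sin y * Real.sin (y + Real.pi / 3)) *
      Real.sin (Real.pi / 3 - y) := by
    rw [Real.sin_three_mul, Real.sin_add, Real.sin_sub, Real.sin_pi_div_three,
      Real.cos_pi_div_three]
    linear_combination (-Real.sin y * Real.cos y ^ 2) * hsq + (-3 * Real.sin y) * hcs
  have hw0 : Real.sin (Real.pi / 3 - y) ≠ 0 := fun h => hs0 (by rw [hden, h, mul_zero])
  rw [hnum, hden]
  generalize Real.sin (y + Real.pi / 3) = B at *
  generalize Real.sin (Real.pi / 3 - y) = C at *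
  field_simp
  linear_combination 4 * hsq

lemma quadratic_scaling {a : ℝ} (ha : 0 < a) (p : ℝ) {t : ℝ} (ht : 0 < t) :
    (a * t) ^ (p - 1) / ((a * t) ^ 2 + a * (a * t) + a ^ 2) =
      a ^ (p - 3) * (t ^ (p - 1) / (t ^ 2 + t + 1)) := by
  rw [Real.mul_rpow ha.le ht.le, show p - 3 = (p - 1) - (2 : ℕ) by push_cast; ring,
    Real.rpow_sub_natCast ha.ne']
  field_simp

lemma integrableOn_rpow_div {a p : ℝ} (ha : 0 < a) (hp0 : 0 < p) (hp2 : p < 2) :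
    IntegrableOn (fun t : ℝ => t ^ (p - 1) / (t ^ 2 + a * t + a ^ 2)) (Set.Ioi 0) := by
  have h := integrableOn_Ioi_comp_mul_left_iff
    (fun t : ℝ => t ^ (p - 1) / (t ^ 2 + a * t + a ^ 2)) 0 ha
  rw [mul_zero] at h
  rw [← h]
  exact IntegrableOn.congr_fun
    ((integrableOn_rpow_div_quadratic hp0 hp2).const_mul (a ^ (p - 3)))
    (fun t ht => (quadratic_scaling ha p ht).symm) measurableSet_Ioi

lemma integral_rpow_div {a p : ℝ} (ha : 0 < a) (hp0 : 0 < p) (hp2 : p < 2) (hp1 : p ≠ 1) :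
    ∫ t in Set.Ioi (0 : ℝ), t ^ (p - 1) / (t ^ 2 + a * t + a ^ 2) =
      a ^ (p - 2) *
        (2 * Real.pi / √3 * Real.sin (Real.pi * (1 - p) / 3) / Real.sin (Real.pi * p)) := by
  have h := integral_comp_mul_left_Ioi'
    (fun t : ℝ => t ^ (p - 1) / (t ^ 2 + a * t + a ^ 2)) 0 ha
  rw [mul_zero] at h
  rw [← h, setIntegral_congr_fun measurableSet_Ioi fun t ht => quadratic_scaling ha p ht,
    integral_const_mul, integral_rpow_div_quadratic hp0 hp2 hp1, smul_eq_mul, ← mul_assoc,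
    show p - 2 = (p - 3) + 1 by ring, Real.rpow_add_one ha.ne', mul_comm a]

lemma iteratedDeriv_sin_const_mul_zero (c : ℝ) (j : ℕ) :
    iteratedDeriv j (fun s => Real.sin (c * s)) 0 =
      (if Odd j then (-1) ^ (j / 2) else 0) * c ^ j := by
  rw [iteratedDeriv_comp_const_mul Real.contDiff_sin]
  rcases Nat.even_or_odd' j with ⟨m, rfl | rfl⟩
  · simp [Real.iteratedDeriv_even_sin]
  · have : (2 * m + 1) / 2 = m := by omega
    rw [this, Real.iteratedDeriv_odd_sin]
    simp [mul_comm]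

lemma iteratedDeriv_cos_const_mul_zero (c : ℝ) (j : ℕ) :
    iteratedDeriv j (fun s => Real.cos (c * s)) 0 =
      (if Even j then (-1) ^ (j / 2) else 0) * c ^ j := by
  rw [iteratedDeriv_comp_const_mul Real.contDiff_cos]
  rcases Nat.even_or_odd' j with ⟨m, rfl | rfl⟩
  · rw [Real.iteratedDeriv_even_cos]
    simp
    ring
  · rw [Real.iteratedDeriv_odd_cos]
    simp

lemma iteratedDeriv_exp_const_mul_zero (c : ℝ) (j : ℕ) :
    iteratedDeriv j (fun s => Real.exp (c * s)) 0 = c ^ j := by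
  rw [iteratedDeriv_comp_const_mul Real.contDiff_exp]
  simp [iteratedDeriv_eq_iterate, Real.iter_deriv_exp]

lemma recFam_eq (m : ℝ) (G : ℕ → Polynomial ℝ) (k : ℕ) :
    recFam m G k = Polynomial.C ((1 : ℝ) / (k + 1)) *
      (∑ j ∈ (Finset.range (k + 2)).filter (fun j => Odd j ∧ 3 ≤ j),
        Polynomial.C ((-1 : ℝ) ^ ((j + 1) / 2) * ((k + 1).choose j : ℝ) * m ^ (j - 1)) *
          recFam m G (k + 1 - j)) + G k := by
  rw [← Finset.sum_attach]
  conv_lhs => rw [recFam, Nat.strongRecOn_eq]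
  rfl

/-- The recursion of `recFam`, as a convolution with the Taylor coefficients of `sin (m * ·)`. -/
lemma sum_choose_mul_recFam_eval (m : ℝ) (G : ℕ → Polynomial ℝ) (k : ℕ) (x : ℝ) :
    ∑ j ∈ Finset.range (k + 2), ((k + 1).choose j : ℝ) *
        ((if Odd j then (-1) ^ (j / 2) else 0) * m ^ j) * (recFam m G (k + 1 - j)).eval x =
      m * (k + 1) * (G k).eval x := by
  have h1 := congrArg (fun q => m * (k + 1) * Polynomial.eval x q) (recFam_eq m G k)
  have hk : (k : ℝ) + 1 ≠ 0 := by positivity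
  simp only [Polynomial.eval_add, Polynomial.eval_mul, Polynomial.eval_C,
    Polynomial.eval_finsetSum] at h1
  have h2 : ∑ j ∈ Finset.range (k + 2), ((k + 1).choose j : ℝ) *
        ((if Odd j then (-1) ^ (j / 2) else 0) * m ^ j) * (recFam m G (k + 1 - j)).eval x =
      m * (k + 1) * (recFam m G k).eval x +
      ∑ j ∈ (Finset.range (k + 2)).filter (fun j => Odd j ∧ 3 ≤ j), ((k + 1).choose j : ℝ) *
        ((if Odd j then (-1) ^ (j / 2) else 0) * m ^ j) * (recFam m G (k + 1 - j)).eval x := by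
    rw [← Finset.sum_filter_add_sum_filter_not (Finset.range (k + 2)) (fun j => Odd j ∧ 3 ≤ j),
      add_comm]
    congr 1
    rw [Finset.sum_eq_single_of_mem 1 (by simp)]
    · rw [Nat.choose_one_right, if_pos odd_one, Nat.add_sub_cancel, show 1 / 2 = 0 from rfl,
        pow_zero, pow_one, one_mul]
      push_cast
      ring
    · intro j hj hj1
      simp only [Finset.mem_filter, Finset.mem_range, not_and, not_le] at hj
      have : ¬ Odd j := by
        intro ho
        have := hj.2 ho
        interval_cases j
        · simp at ho
        · exact hj1 rfl
        · exact absurd ho (by decide)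
      simp [this]
  rw [h2, h1, mul_add, add_right_comm]
  rw [add_eq_right, ← mul_assoc, mul_one_div, mul_div_assoc, div_self hk, mul_one,
    Finset.mul_sum, ← Finset.sum_add_distrib]
  refine Finset.sum_eq_zero fun j hj => ?_
  simp only [Finset.mem_filter, Finset.mem_range] at hj
  obtain ⟨i, rfl⟩ := hj.2.1
  have e1 : (2 * i + 1) / 2 = i := by omega
  have e2 : (2 * i + 1 + 1) / 2 = i + 1 := by omega
  rw [if_pos hj.2.1, e1, e2, Nat.add_sub_cancel, pow_succ, pow_succ]
  ring

lemma GR_eval (k : ℕ) (x : ℝ) :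
    (k + 1) * (GR k).eval x = 1 / 2 * ∑ j ∈ Finset.range (k + 2), ((k + 1).choose j : ℝ) *
      ((if Even j then (-1) ^ (j / 2) else 0) * (2 ^ j + 1)) * x ^ (k + 1 - j) := by
  have hk : (k : ℝ) + 1 ≠ 0 := by positivity
  simp only [GR, Polynomial.eval_mul, Polynomial.eval_C, Polynomial.eval_finsetSum,
    Polynomial.eval_pow, Polynomial.eval_X]
  rw [Finset.sum_filter, ← mul_assoc]
  congr 1
  · field_simp
  · refine Finset.sum_congr rfl fun j _ => ?_
    split_ifs
    · ring
    · ring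

lemma GS_eval (k : ℕ) (x : ℝ) :
    (k + 1) * (GS k).eval x = -(1 / 2) * ∑ j ∈ Finset.range (k + 2), ((k + 1).choose j : ℝ) *
      ((if Odd j then (-1) ^ (j / 2) else 0) * (2 ^ j - 1)) * x ^ (k + 1 - j) := by
  have hk : (k : ℝ) + 1 ≠ 0 := by positivity
  simp only [GS, Polynomial.eval_mul, Polynomial.eval_C, Polynomial.eval_finsetSum,
    Polynomial.eval_pow, Polynomial.eval_X]
  rw [Finset.sum_filter, ← mul_assoc, neg_mul, ← mul_neg, ← Finset.sum_neg_distrib]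
  congr 1
  · field_simp
  · refine Finset.sum_congr rfl fun j _ => ?_
    split_ifs with h
    · obtain ⟨i, rfl⟩ := h
      have e1 : (2 * i + 1) / 2 = i := by omega
      have e2 : (2 * i + 1 + 1) / 2 = i + 1 := by omega
      rw [e1, e2, pow_succ (-1 : ℝ)]
      ring
    · ring

/-- Rescaling of a binomial convolution by powers of `c`. -/
lemma sum_choose_rescale {c : ℝ} (n : ℕ) (m : ℝ) (d u : ℕ → ℝ) :
    ∑ j ∈ Finset.range (n + 1), (n.choose j : ℝ) * (d j * (m * c) ^ j) *
        (c ^ (n - j + 1) * u (n - j)) =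
      c ^ (n + 1) * ∑ j ∈ Finset.range (n + 1), (n.choose j : ℝ) * (d j * m ^ j) * u (n - j) := by
  rw [Finset.mul_sum]
  refine Finset.sum_congr rfl fun j hj => ?_
  have hj' : n + 1 = j + (n - j + 1) := by
    have := Finset.mem_range.mp hj
    omega
  rw [hj', pow_add, mul_pow]
  ring


lemma sum_choose_mul_Rpoly_eval {θ : ℝ} (hθ : θ ≠ 0) (L : ℝ) (k : ℕ) :
    ∑ j ∈ Finset.range (k + 2), ((k + 1).choose j : ℝ) *
        ((if Odd j then (-1) ^ (j / 2) else 0) * (3 * θ) ^ j) *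
        (θ ^ (k + 1 - j + 1) * (Rpoly (k + 1 - j)).eval (L / θ)) =
      3 / 2 * θ * iteratedDeriv (k + 1)
        (fun s => (Real.cos (2 * θ * s) + Real.cos (θ * s)) * Real.exp (L * s)) 0 := by
  rw [sum_choose_rescale (k + 1) 3 _ (fun i => (Rpoly i).eval (L / θ)),
    Rpoly, sum_choose_mul_recFam_eval, mul_assoc 3, GR_eval,
    show (fun s => (Real.cos (2 * θ * s) + Real.cos (θ * s)) * Real.exp (L * s)) =
      (fun s => Real.cos (2 * θ * s) + Real.cos (θ * s)) * (fun s => Real.exp (L * s)) from rfl,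
    iteratedDeriv_mul (by fun_prop) (by fun_prop), Finset.mul_sum, Finset.mul_sum, Finset.mul_sum,
    Finset.mul_sum]
  refine Finset.sum_congr rfl fun j hj => ?_
  rw [iteratedDeriv_fun_add (by fun_prop) (by fun_prop), iteratedDeriv_cos_const_mul_zero,
    iteratedDeriv_cos_const_mul_zero, iteratedDeriv_exp_const_mul_zero, div_pow, mul_pow]
  have hj' : k + 1 + 1 = 1 + j + (k + 1 - j) := by
    have := Finset.mem_range.mp hj
    omega
  rw [hj', pow_add, pow_add, pow_one]
  field_simp

lemma sum_choose_mul_Spoly_eval {θ : ℝ} (hθ : θ ≠ 0) (L : ℝ) (k : ℕ) :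
    ∑ j ∈ Finset.range (k + 2), ((k + 1).choose j : ℝ) *
        ((if Odd j then (-1) ^ (j / 2) else 0) * (3 * θ) ^ j) *
        (θ ^ (k + 1 - j + 1) * (Spoly (k + 1 - j)).eval (L / θ)) =
      -(3 / 2 * θ) * iteratedDeriv (k + 1)
        (fun s => (Real.sin (2 * θ * s) - Real.sin (θ * s)) * Real.exp (L * s)) 0 := by
  rw [sum_choose_rescale (k + 1) 3 _ (fun i => (Spoly i).eval (L / θ)),
    Spoly, sum_choose_mul_recFam_eval, mul_assoc 3, GS_eval,
    show (fun s => (Real.sin (2 * θ * s) - Real.sin (θ * s)) * Real.exp (L * s)) =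
      (fun s => Real.sin (2 * θ * s) - Real.sin (θ * s)) * (fun s => Real.exp (L * s)) from rfl,
    iteratedDeriv_mul (by fun_prop) (by fun_prop), Finset.mul_sum, Finset.mul_sum, Finset.mul_sum,
    Finset.mul_sum]
  refine Finset.sum_congr rfl fun j hj => ?_
  rw [iteratedDeriv_fun_sub (by fun_prop) (by fun_prop), iteratedDeriv_sin_const_mul_zero,
    iteratedDeriv_sin_const_mul_zero, iteratedDeriv_exp_const_mul_zero, div_pow, mul_pow]
  have hj' : k + 1 + 1 = 1 + j + (k + 1 - j) := by
    have := Finset.mem_range.mp hj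
    omega
  rw [hj', pow_add, pow_add, pow_one]
  field_simp

lemma eq_of_sum_choose_mul_eq {d u v : ℕ → ℝ} (h0 : d 0 = 0) (h1 : d 1 ≠ 0)
    (h : ∀ k, ∑ j ∈ Finset.range (k + 2), ((k + 1).choose j : ℝ) * d j * u (k + 1 - j) =
      ∑ j ∈ Finset.range (k + 2), ((k + 1).choose j : ℝ) * d j * v (k + 1 - j)) (k : ℕ) :
    u k = v k := by
  induction k using Nat.strong_induction_on with
  | _ k ih =>
    have hk := h k
    rw [← sub_eq_zero, ← Finset.sum_sub_distrib, Finset.sum_eq_single_of_mem 1 (by simp)] at hk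
    · rw [Nat.add_sub_cancel, ← mul_sub, Nat.choose_one_right] at hk
      have hk0 : ((k + 1 : ℕ) : ℝ) ≠ 0 := by positivity
      exact sub_eq_zero.mp ((mul_eq_zero.mp hk).resolve_left (mul_ne_zero hk0 h1))
    · intro j hj hj1
      rcases Nat.eq_zero_or_pos j with rfl | hj0
      · simp [h0]
      · have := Finset.mem_range.mp hj
        rw [ih (k + 1 - j) (by omega), sub_self]

lemma pow_three_sub_pow_three_ne_zero {a b : ℝ} (ha : 0 < a) (hb : 0 < b) (hab : a ≠ b) :
    a ^ 3 - b ^ 3 ≠ 0 := by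
  rw [show a ^ 3 - b ^ 3 = (a - b) * (a ^ 2 + a * b + b ^ 2) by ring]
  exact mul_ne_zero (sub_ne_zero.mpr hab) (by positivity)

lemma integral_rpow_mul_weight {a b s : ℝ} (ha : 0 < a) (hb : 0 < b) (hab : a ≠ b)
    (hs1 : -1 < s) (hs0 : s < 0) :
    ∫ t in Set.Ioi (0 : ℝ), t / ((t ^ 2 + a * t + a ^ 2) * (t ^ 2 + b * t + b ^ 2)) * t ^ s =
      2 * Real.pi / √3 / (a ^ 3 - b ^ 3) *
        ((a + b) * (a ^ s - b ^ s) * (Real.sin (Real.pi * s / 3 + Real.pi / 3) /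
            Real.sin (Real.pi * s))
          - (a * a ^ s - b * b ^ s) * (Real.sin (Real.pi * s / 3) / Real.sin (Real.pi * s))) := by
  have hK := pow_three_sub_pow_three_ne_zero ha hb hab
  have hpf : Set.EqOn
      (fun t : ℝ => t / ((t ^ 2 + a * t + a ^ 2) * (t ^ 2 + b * t + b ^ 2)) * t ^ s)
      (fun t : ℝ => 1 / (a ^ 3 - b ^ 3) *
        ((a + b) * (t ^ (s + 2 - 1) / (t ^ 2 + b * t + b ^ 2)
            - t ^ (s + 2 - 1) / (t ^ 2 + a * t + a ^ 2))
          + (b ^ 2 * (t ^ (s + 1 - 1) / (t ^ 2 + b * t + b ^ 2))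
            - a ^ 2 * (t ^ (s + 1 - 1) / (t ^ 2 + a * t + a ^ 2))))) (Set.Ioi 0) := by
    intro t ht
    have ht0 : 0 < t := ht
    have hP : t ^ 2 + a * t + a ^ 2 ≠ 0 := by positivity
    have hQ : t ^ 2 + b * t + b ^ 2 ≠ 0 := by positivity
    simp only
    rw [show s + 2 - 1 = s + 1 by ring, show s + 1 - 1 = s by ring, Real.rpow_add_one ht0.ne']
    field_simp
    ring
  have iA (c : ℝ) (hc : 0 < c) := integrableOn_rpow_div (a := c) (p := s + 2) hc
    (by linarith) (by linarith)
  have iB (c : ℝ) (hc : 0 < c) := integrableOn_rpow_div (a := c) (p := s + 1) hc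
    (by linarith) (by linarith)
  have vA (c : ℝ) (hc : 0 < c) := integral_rpow_div (a := c) (p := s + 2) hc
    (by linarith) (by linarith) (by linarith)
  have vB (c : ℝ) (hc : 0 < c) := integral_rpow_div (a := c) (p := s + 1) hc
    (by linarith) (by linarith) (by linarith)
  have jA : IntegrableOn (fun t : ℝ => (a + b) * (t ^ (s + 2 - 1) / (t ^ 2 + b * t + b ^ 2)
      - t ^ (s + 2 - 1) / (t ^ 2 + a * t + a ^ 2))) (Set.Ioi 0) :=
    ((iA b hb).sub (iA a ha)).const_mul _
  have jB : IntegrableOn (fun t : ℝ => b ^ 2 * (t ^ (s + 1 - 1) / (t ^ 2 + b * t + b ^ 2))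
      - a ^ 2 * (t ^ (s + 1 - 1) / (t ^ 2 + a * t + a ^ 2))) (Set.Ioi 0) :=
    ((iB b hb).const_mul _).sub ((iB a ha).const_mul _)
  rw [setIntegral_congr_fun measurableSet_Ioi hpf, integral_const_mul, integral_add jA jB,
    integral_const_mul, integral_sub (iA b hb) (iA a ha),
    integral_sub ((iB b hb).const_mul _) ((iB a ha).const_mul _),
    integral_const_mul, integral_const_mul, vA a ha, vA b hb, vB a ha, vB b hb]
  have e1 : Real.pi * (1 - (s + 2)) / 3 = -(Real.pi * s / 3 + Real.pi / 3) := by ring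
  have e2 : Real.pi * (1 - (s + 1)) / 3 = -(Real.pi * s / 3) := by ring
  have e3 : Real.pi * (s + 2) = Real.pi * s + 2 * Real.pi := by ring
  have e4 : Real.pi * (s + 1) = Real.pi * s + Real.pi := by ring
  have e5 (c : ℝ) (hc : 0 < c) : c ^ 2 * c ^ (s + 1 - 2) = c * c ^ s := by
    rw [show s + 1 - 2 = s - 1 by ring, Real.rpow_sub_one hc.ne']
    field_simp
  rw [e1, e2, e3, e4, Real.sin_add_two_pi, Real.sin_add_pi, Real.sin_neg, Real.sin_neg,
    ← mul_assoc (b ^ 2), ← mul_assoc (a ^ 2), e5 a ha, e5 b hb, add_sub_cancel_right]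
  simp only [mul_neg, neg_div_neg_eq]
  ring

lemma sin_mul_integral_rpow_mul_weight {a b s : ℝ} (ha : 0 < a) (hb : 0 < b) (hab : a ≠ b)
    (hs1 : -1 < s) (hs0 : s < 0) :
    Real.sin (2 * Real.pi * s) *
      ∫ t in Set.Ioi (0 : ℝ), t / ((t ^ 2 + a * t + a ^ 2) * (t ^ 2 + b * t + b ^ 2)) * t ^ s =
      (a + b) / (a ^ 3 - b ^ 3) * Real.pi * ((a ^ s - b ^ s) *
        (Real.cos (4 * (Real.pi * s / 3)) + Real.cos (2 * (Real.pi * s / 3))))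
      - 1 / (√3 * (a ^ 2 + a * b + b ^ 2)) * Real.pi * ((a ^ s + b ^ s) *
        (Real.sin (4 * (Real.pi * s / 3)) - Real.sin (2 * (Real.pi * s / 3)))) := by
  have hK := pow_three_sub_pow_three_ne_zero ha hb hab
  have hab' : a - b ≠ 0 := sub_ne_zero.mpr hab
  have hD : a ^ 2 + a * b + b ^ 2 ≠ 0 := by positivity
  have hs : Real.sin (Real.pi * s) ≠ 0 :=
    (Real.sin_neg_of_neg_of_neg_pi_lt (by nlinarith [Real.pi_pos]) (by nlinarith [Real.pi_pos])).ne
  have hsq : √3 ^ 2 = 3 := Real.sq_sqrt (by norm_num)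
  have hsq0 : √3 ≠ 0 := by positivity
  rw [integral_rpow_mul_weight ha hb hab hs1 hs0, show 2 * Real.pi * s = 2 * (Real.pi * s) by ring,
    Real.sin_two_mul (Real.pi * s)]
  have h3 : Real.pi * s = 3 * (Real.pi * s / 3) := by ring
  have hC : Real.cos (4 * (Real.pi * s / 3)) + Real.cos (2 * (Real.pi * s / 3)) =
      2 * Real.cos (Real.pi * s) * Real.cos (Real.pi * s / 3) := by
    rw [Real.cos_add_cos]
    ring_nf
  have hS : Real.sin (4 * (Real.pi * s / 3)) - Real.sin (2 * (Real.pi * s / 3)) =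
      2 * Real.cos (Real.pi * s) * Real.sin (Real.pi * s / 3) := by
    rw [Real.sin_sub_sin]
    ring_nf
  rw [hC, hS, Real.sin_add, Real.sin_pi_div_three, Real.cos_pi_div_three]
  rw [show a ^ 3 - b ^ 3 = (a - b) * (a ^ 2 + a * b + b ^ 2) by ring]
  generalize Real.sin (Real.pi * s / 3) = S
  generalize Real.cos (Real.pi * s / 3) = C
  generalize Real.cos (Real.pi * s) = T
  field_simp
  ring

/-- The measure on `(0, ∞)` with density `t / ((t² + a t + a²) (t² + b t + b²))`. -/
noncomputable def weightMeasure (a b : ℝ) : Measure ℝ :=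
  (volume.restrict (Set.Ioi (0 : ℝ))).withDensity fun t =>
    ENNReal.ofReal (t / ((t ^ 2 + a * t + a ^ 2) * (t ^ 2 + b * t + b ^ 2)))

lemma integral_weightMeasure {a b : ℝ} (ha : 0 < a) (hb : 0 < b) (g : ℝ → ℝ) :
    ∫ t, g t ∂(weightMeasure a b) = ∫ t in Set.Ioi (0 : ℝ),
      t / ((t ^ 2 + a * t + a ^ 2) * (t ^ 2 + b * t + b ^ 2)) * g t := by
  rw [weightMeasure, integral_withDensity_eq_integral_toReal_smul (by fun_prop) (by simp)]
  refine setIntegral_congr_fun measurableSet_Ioi fun t ht => ?_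
  have ht0 : 0 < t := ht
  simp only [smul_eq_mul]
  rw [ENNReal.toReal_ofReal (by positivity)]

lemma integrable_weightMeasure_iff {a b : ℝ} (ha : 0 < a) (hb : 0 < b) (g : ℝ → ℝ) :
    Integrable g (weightMeasure a b) ↔ IntegrableOn (fun t =>
      t / ((t ^ 2 + a * t + a ^ 2) * (t ^ 2 + b * t + b ^ 2)) * g t) (Set.Ioi 0) := by
  rw [weightMeasure, integrable_withDensity_iff_integrable_smul' (by fun_prop) (by simp)]
  refine integrableOn_congr_fun (fun t ht => ?_) measurableSet_Ioi
  have ht0 : 0 < t := ht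
  simp only [smul_eq_mul]
  rw [ENNReal.toReal_ofReal (by positivity)]

lemma mgf_log_weightMeasure {a b : ℝ} (ha : 0 < a) (hb : 0 < b) (s : ℝ) :
    ProbabilityTheory.mgf Real.log (weightMeasure a b) s = ∫ t in Set.Ioi (0 : ℝ),
      t / ((t ^ 2 + a * t + a ^ 2) * (t ^ 2 + b * t + b ^ 2)) * t ^ s := by
  rw [ProbabilityTheory.mgf, integral_weightMeasure ha hb]
  refine setIntegral_congr_fun measurableSet_Ioi fun t ht => ?_
  rw [Real.rpow_def_of_pos ht, mul_comm s]

lemma Ioo_subset_interior_integrableExpSet {a b : ℝ} (ha : 0 < a) (hb : 0 < b) :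
    Set.Ioo (-1) 1 ⊆
      interior (ProbabilityTheory.integrableExpSet Real.log (weightMeasure a b)) := by
  refine interior_maximal (fun s hs => ?_) isOpen_Ioo
  refine (integrable_weightMeasure_iff ha hb _).mpr ?_
  refine Integrable.mono' ((integrableOn_rpow_div (a := a) (p := s + 1) ha (by linarith [hs.1])
    (by linarith [hs.2])).const_mul (1 / b))
    (by fun_prop : Measurable _).aestronglyMeasurable ?_
  filter_upwards [ae_restrict_mem measurableSet_Ioi] with t ht
  have ht0 : 0 < t := ht
  rw [mul_comm s, ← Real.rpow_def_of_pos ht, Real.norm_of_nonneg (by positivity),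
    add_sub_cancel_right, div_mul_eq_mul_div, one_div_mul_eq_div, div_div,
    div_le_div_iff₀ (by positivity) (by positivity)]
  have h1 : t * b ≤ t ^ 2 + b * t + b ^ 2 := by nlinarith
  have h2 : 0 ≤ t ^ s * (t ^ 2 + a * t + a ^ 2) := by positivity
  nlinarith [mul_le_mul_of_nonneg_left h1 h2]

lemma iteratedDeriv_mgf_log_weightMeasure {a b : ℝ} (ha : 0 < a) (hb : 0 < b) (k : ℕ) :
    iteratedDeriv k (ProbabilityTheory.mgf Real.log (weightMeasure a b)) 0 =
      ∫ t in Set.Ioi (0 : ℝ),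
        t * Real.log t ^ k / ((t ^ 2 + a * t + a ^ 2) * (t ^ 2 + b * t + b ^ 2)) := by
  rw [ProbabilityTheory.iteratedDeriv_mgf_zero
    (Ioo_subset_interior_integrableExpSet ha hb (by norm_num)), integral_weightMeasure ha hb]
  refine setIntegral_congr_fun measurableSet_Ioi fun t _ => ?_
  simp only [Pi.pow_apply]
  ring

lemma sin_mul_mgf_eventuallyEq {a b : ℝ} (ha : 0 < a) (hb : 0 < b) (hab : a ≠ b) {θ : ℝ}
    (hθ : θ = 2 * Real.pi / 3) :
    (fun s => Real.sin (3 * θ * s)) * ProbabilityTheory.mgf Real.log (weightMeasure a b)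
      =ᶠ[nhds 0] fun s =>
        ((a + b) / (a ^ 3 - b ^ 3)) * ((3 / 2 * θ) *
          ((Real.cos (2 * θ * s) + Real.cos (θ * s)) * Real.exp (Real.log a * s)
            - (Real.cos (2 * θ * s) + Real.cos (θ * s)) * Real.exp (Real.log b * s)))
        + (1 / (√3 * (a ^ 2 + a * b + b ^ 2))) * (-(3 / 2 * θ) *
          ((Real.sin (2 * θ * s) - Real.sin (θ * s)) * Real.exp (Real.log a * s)
            + (Real.sin (2 * θ * s) - Real.sin (θ * s)) * Real.exp (Real.log b * s))) := by
  have hsin (c : ℝ) : AnalyticOnNhd ℝ (fun s => Real.sin (c * s)) (Set.Ioo (-1) 1) := fun s _ => by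
    fun_prop
  have hmgf := (ProbabilityTheory.analyticOnNhd_mgf (X := Real.log) (μ := weightMeasure a b)).mono
    (Ioo_subset_interior_integrableExpSet ha hb)
  have heq := ((hsin (3 * θ)).mul hmgf).eqOn_of_preconnected_of_eventuallyEq
    (g := fun s =>
        ((a + b) / (a ^ 3 - b ^ 3)) * ((3 / 2 * θ) *
          ((Real.cos (2 * θ * s) + Real.cos (θ * s)) * Real.exp (Real.log a * s)
            - (Real.cos (2 * θ * s) + Real.cos (θ * s)) * Real.exp (Real.log b * s)))
        + (1 / (√3 * (a ^ 2 + a * b + b ^ 2))) * (-(3 / 2 * θ) *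
          ((Real.sin (2 * θ * s) - Real.sin (θ * s)) * Real.exp (Real.log a * s)
            + (Real.sin (2 * θ * s) - Real.sin (θ * s)) * Real.exp (Real.log b * s))))
    (z₀ := -1 / 2) (fun s _ => by fun_prop) isPreconnected_Ioo (by norm_num) ?_
  · exact heq.eventuallyEq_of_mem (Ioo_mem_nhds (by norm_num) (by norm_num))
  · filter_upwards [Ioo_mem_nhds (a := (-1 : ℝ)) (b := 0) (by norm_num) (by norm_num)] with s hs
    rw [mgf_log_weightMeasure ha hb, show 3 * θ * s = 2 * Real.pi * s by rw [hθ]; ring,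
      sin_mul_integral_rpow_mul_weight ha hb hab hs.1 hs.2, Real.rpow_def_of_pos ha,
      Real.rpow_def_of_pos hb, show 2 * θ * s = 4 * (Real.pi * s / 3) by rw [hθ]; ring,
      show θ * s = 2 * (Real.pi * s / 3) by rw [hθ]; ring,
      show 3 / 2 * θ = Real.pi by rw [hθ]; ring]
    ring

/-- The integral `f₁(k) = ∫₀^∞ t logᵏt /((t²+at+a²)(t²+bt+b²)) dt` in terms of the
recursive polynomials `R_k` and `S_k`, with `θ = 2π/3`. -/
theorem f1_eval (a b : ℝ) (ha : 0 < a) (hb : 0 < b) (hab : a ≠ b) (k : ℕ) :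
    ∫ t in Set.Ioi (0 : ℝ),
        t * Real.log t ^ k / ((t ^ 2 + a * t + a ^ 2) * (t ^ 2 + b * t + b ^ 2)) =
      (2 * Real.pi / 3) ^ (k + 1) * (a + b) / (a ^ 3 - b ^ 3) *
          ((Rpoly k).eval (Real.log a / (2 * Real.pi / 3))
            - (Rpoly k).eval (Real.log b / (2 * Real.pi / 3)))
        + (2 * Real.pi / 3) ^ (k + 1) / (Real.sqrt 3 * (a ^ 2 + a * b + b ^ 2)) *
          ((Spoly k).eval (Real.log a / (2 * Real.pi / 3))
            + (Spoly k).eval (Real.log b / (2 * Real.pi / 3))) := by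
  set θ := 2 * Real.pi / 3 with hθ
  have hθ0 : θ ≠ 0 := by positivity
  refine eq_of_sum_choose_mul_eq
    (d := fun j => (if Odd j then (-1) ^ (j / 2) else 0) * (3 * θ) ^ j)
    (u := fun k => ∫ t in Set.Ioi (0 : ℝ),
        t * Real.log t ^ k / ((t ^ 2 + a * t + a ^ 2) * (t ^ 2 + b * t + b ^ 2)))
    (v := fun k => θ ^ (k + 1) * (a + b) / (a ^ 3 - b ^ 3) *
          ((Rpoly k).eval (Real.log a / θ) - (Rpoly k).eval (Real.log b / θ))
        + θ ^ (k + 1) / (Real.sqrt 3 * (a ^ 2 + a * b + b ^ 2)) *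
          ((Spoly k).eval (Real.log a / θ) + (Spoly k).eval (Real.log b / θ)))
    (by simp) (by simpa using hθ0) (fun n => ?_) k
  have hmgf : ContDiffAt ℝ (n + 1 : ℕ)
      (ProbabilityTheory.mgf Real.log (weightMeasure a b)) 0 :=
    (ProbabilityTheory.analyticAt_mgf
      (Ioo_subset_interior_integrableExpSet ha hb (by norm_num))).contDiffAt
  have h := (sin_mul_mgf_eventuallyEq ha hb hab hθ).iteratedDeriv_eq (n + 1)
  rw [iteratedDeriv_mul (by fun_prop) hmgf, iteratedDeriv_fun_add (by fun_prop) (by fun_prop),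
    iteratedDeriv_const_mul_field, iteratedDeriv_const_mul_field, iteratedDeriv_const_mul_field,
    iteratedDeriv_const_mul_field, iteratedDeriv_fun_sub (by fun_prop) (by fun_prop),
    iteratedDeriv_fun_add (by fun_prop) (by fun_prop), mul_sub (3 / 2 * θ),
    mul_add (-(3 / 2 * θ)), ← sum_choose_mul_Rpoly_eval hθ0, ← sum_choose_mul_Rpoly_eval hθ0,
    ← sum_choose_mul_Spoly_eval hθ0, ← sum_choose_mul_Spoly_eval hθ0, ← Finset.sum_sub_distrib,
    ← Finset.sum_add_distrib, Finset.mul_sum, Finset.mul_sum, ← Finset.sum_add_distrib] at h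
  simp only [iteratedDeriv_sin_const_mul_zero, iteratedDeriv_mgf_log_weightMeasure ha hb] at h
  rw [h]
  refine Finset.sum_congr rfl fun j _ => ?_
  ring
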